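/- Let Γ be the pre-Sierpiński-carpet metric space: with l = 3 and the eight contractions h_k(x) = x/3 + q_k generating the level-n approximations F_n of the planar Sierpiński carpet F_∞ ⊂ [0,1]², set X_0 = ∪_{n≥0} 3^n F_n and X_∞ = ∪_{n≥0} 3^n F_∞, each equipped with its intrinsic (geodesic) metric induced from the ℓ¹ metric on ℝ². Let X̃_n = 3^{-n} X_0 with metric d̃_n(x,y) = 3^{-n} d_0(3^n x, 3^n y). Then sup_{x,y ∈ X_∞} |d_∞(x,y) − d̃_n(x,y)| ≤ C 3^{-n} for a constant C independent of n; in particular (X̃_n, d̃_n, 0) converges in the pointed Gromov–Hausdorff sense to (X_∞, d_∞, 0). -/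

import Mathlib

open Set Metric

/-- The plane with the ℓ¹ metric. -/
abbrev PlaneL1 : Type := WithLp 1 (ℝ × ℝ)

noncomputable def mkPt (a b : ℝ) : PlaneL1 := (WithLp.equiv 1 (ℝ × ℝ)).symm (a, b)

/-- The eight translation points for the Sierpiński carpet contractions. -/
noncomputable def carpetPt : Fin 8 → PlaneL1
  | 0 => mkPt 0 0
  | 1 => mkPt (1/3) 0
  | 2 => mkPt (2/3) 0
  | 3 => mkPt (2/3) (1/3)
  | 4 => mkPt (2/3) (2/3)
  | 5 => mkPt (1/3) (2/3)
  | 6 => mkPt 0 (2/3)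
  | 7 => mkPt 0 (1/3)

/-- The contraction `h_k(x) = x/3 + q_k`. -/
noncomputable def carpetMap (k : Fin 8) (x : PlaneL1) : PlaneL1 :=
  (3 : ℝ)⁻¹ • x + carpetPt k

/-- The level-`n` approximations `F_n` of the Sierpiński carpet. -/
noncomputable def carpetApprox : ℕ → Set PlaneL1
  | 0 => {x | (WithLp.equiv 1 (ℝ × ℝ) x).1 ∈ Set.Icc (0:ℝ) 1 ∧
              (WithLp.equiv 1 (ℝ × ℝ) x).2 ∈ Set.Icc (0:ℝ) 1}
  | n + 1 => ⋃ k : Fin 8, carpetMap k '' carpetApprox n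

/-- The standard planar Sierpiński carpet `F_∞`. -/
noncomputable def carpet : Set PlaneL1 := ⋂ n, carpetApprox n

/-- The pre-carpet `X₀ = ∪ₙ 3ⁿ Fₙ`. -/
noncomputable def preCarpet : Set PlaneL1 :=
  ⋃ n : ℕ, (fun x => ((3:ℝ) ^ n) • x) '' carpetApprox n

/-- The unbounded Sierpiński carpet `X_∞ = ∪ₙ 3ⁿ F_∞`. -/
noncomputable def unboundedCarpet : Set PlaneL1 :=
  ⋃ n : ℕ, (fun x => ((3:ℝ) ^ n) • x) '' carpet

/-- The intrinsic (length) pseudo-distance of a subset `S`: the infimum of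
lengths (total variations) of continuous paths in `S` joining two points. -/
noncomputable def intrinsicDist (S : Set PlaneL1) (x y : PlaneL1) : ENNReal :=
  ⨅ (γ : Path x y) (_ : ∀ t, γ t ∈ S), eVariationOn γ Set.univ

/-- The rescaled pre-carpet metric `d̃ₙ(x,y) = 3⁻ⁿ d₀(3ⁿx, 3ⁿy)`. -/
noncomputable def scaledPreCarpetDist (n : ℕ) (x y : PlaneL1) : ENNReal :=
  ENNReal.ofReal (((3:ℝ) ^ n)⁻¹) *
    intrinsicDist preCarpet (((3:ℝ) ^ n) • x) (((3:ℝ) ^ n) • y)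

@[simp] lemma mkPt_fst (a b : ℝ) : (mkPt a b).fst = a := rfl

@[simp] lemma mkPt_snd (a b : ℝ) : (mkPt a b).snd = b := rfl

lemma PlaneL1.ext {x y : PlaneL1} (h₁ : x.fst = y.fst) (h₂ : x.snd = y.snd) : x = y :=
  WithLp.ofLp_injective 1 (Prod.ext h₁ h₂)

lemma PlaneL1.dist_eq (x y : PlaneL1) :
    dist x y = |x.fst - y.fst| + |x.snd - y.snd| := by
  rw [WithLp.prod_dist_eq_of_L1, Real.dist_eq, Real.dist_eq]

lemma intrinsicDist_le_of_lipschitzWith {S : Set PlaneL1} {f : ℝ → PlaneL1} {K : NNReal}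
    (hf : LipschitzWith K f) (hS : ∀ t ∈ Icc (0 : ℝ) 1, f t ∈ S) :
    intrinsicDist S (f 0) (f 1) ≤ K := by
  let γ : Path (f 0) (f 1) :=
    { toFun := fun t => f t
      continuous_toFun := hf.continuous.comp continuous_subtype_val
      source' := by simp
      target' := by simp }
  refine (iInf₂_le γ fun t : unitInterval => hS _ t.2).trans ?_
  have h : eVariationOn (f ∘ ((↑) : unitInterval → ℝ)) univ ≤
      K * eVariationOn ((↑) : unitInterval → ℝ) univ :=
    (hf.lipschitzOnWith (s := univ)).comp_eVariationOn_le (mapsTo_univ _ _)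
  refine h.trans ?_
  have h' : eVariationOn ((↑) : unitInterval → ℝ) univ ≤ 1 := by
    have := MonotoneOn.eVariationOn_eq (f := ((↑) : unitInterval → ℝ)) (s := univ) (a := 0) (b := 1)
      (fun a _ b _ hab => hab) (mem_univ _) (mem_univ _)
    have hu : (univ : Set unitInterval) ∩ Icc 0 1 = univ := by
      ext t
      simp [unitInterval.le_one']
    simpa [hu] using this.le
  calc (K : ENNReal) * eVariationOn ((↑) : unitInterval → ℝ) univ ≤ K * 1 := by gcongr
    _ = K := mul_one _

lemma intrinsicDist_le_edist_of_segment_subset {S : Set PlaneL1} {x y : PlaneL1}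
    (h : ∀ t ∈ Icc (0 : ℝ) 1, AffineMap.lineMap x y t ∈ S) :
    intrinsicDist S x y ≤ edist x y := by
  have := intrinsicDist_le_of_lipschitzWith (lipschitzWith_lineMap x y) h
  rwa [AffineMap.lineMap_apply_zero, AffineMap.lineMap_apply_one, ← edist_nndist] at this

lemma intrinsicDist_comm_le (S : Set PlaneL1) (x y : PlaneL1) :
    intrinsicDist S x y ≤ intrinsicDist S y x := by
  refine le_iInf₂ fun γ hγ => (iInf₂_le γ.symm fun t => hγ _).trans ?_
  exact eVariationOn.comp_le_of_antitoneOn γ unitInterval.symm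
    (unitInterval.strictAnti_symm.antitone.antitoneOn _) (mapsTo_univ _ _)

lemma intrinsicDist_comm (S : Set PlaneL1) (x y : PlaneL1) :
    intrinsicDist S x y = intrinsicDist S y x :=
  (intrinsicDist_comm_le S x y).antisymm (intrinsicDist_comm_le S y x)

lemma eVariationOn_trans_le {x y z : PlaneL1} (γ : Path x y) (γ' : Path y z) :
    eVariationOn (γ.trans γ') univ ≤ eVariationOn γ univ + eVariationOn γ' univ := by
  let c : unitInterval := ⟨1 / 2, by norm_num, by norm_num⟩
  have hu : (univ : Set unitInterval) = Iic c ∪ Ici c := Iic_union_Ici.symm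
  have hφ : Monotone fun t : unitInterval => projIcc (0 : ℝ) 1 zero_le_one (2 * t) :=
    (monotone_projIcc _).comp fun a b hab => by
      have : (a : ℝ) ≤ b := hab
      linarith
  have hψ : Monotone fun t : unitInterval => projIcc (0 : ℝ) 1 zero_le_one (2 * t - 1) :=
    (monotone_projIcc _).comp fun a b hab => by
      have : (a : ℝ) ≤ b := hab
      linarith
  have h₁ : EqOn (γ.trans γ')
      (γ ∘ fun t : unitInterval => projIcc (0 : ℝ) 1 zero_le_one (2 * t)) (Iic c) := by
    intro t ht
    have ht' : (t : ℝ) ≤ 1 / 2 := ht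
    have hm : 2 * (t : ℝ) ∈ Icc (0 : ℝ) 1 := ⟨by linarith [t.2.1], by linarith⟩
    rw [Path.trans_apply, dif_pos ht', Function.comp_apply, projIcc_of_mem _ hm]
  have h₂ : EqOn (γ.trans γ')
      (γ' ∘ fun t : unitInterval => projIcc (0 : ℝ) 1 zero_le_one (2 * t - 1)) (Ici c) := by
    intro t ht
    have ht' : 1 / 2 ≤ (t : ℝ) := ht
    have hm : 2 * (t : ℝ) - 1 ∈ Icc (0 : ℝ) 1 := ⟨by linarith, by linarith [t.2.2]⟩
    rw [Function.comp_apply, projIcc_of_mem _ hm, Path.trans_apply]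
    split_ifs with h
    · have ht2 : (t : ℝ) = 1 / 2 := le_antisymm h ht'
      simp [ht2]
    · rfl
  rw [hu, eVariationOn.union _ isGreatest_Iic isLeast_Ici, eVariationOn.congr h₁,
    eVariationOn.congr h₂, ← hu]
  exact add_le_add
    (eVariationOn.comp_le_of_monotoneOn γ _ (hφ.monotoneOn _) (mapsTo_univ _ _))
    (eVariationOn.comp_le_of_monotoneOn γ' _ (hψ.monotoneOn _) (mapsTo_univ _ _))

lemma intrinsicDist_triangle (S : Set PlaneL1) (x y z : PlaneL1) :
    intrinsicDist S x z ≤ intrinsicDist S x y + intrinsicDist S y z := by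
  simp only [intrinsicDist, ENNReal.iInf_add, ENNReal.add_iInf]
  refine le_iInf₂ fun γ' hγ' => le_iInf₂ fun γ hγ =>
    (iInf₂_le (γ.trans γ') fun t => ?_).trans (eVariationOn_trans_le γ γ')
  have := (γ.trans_range γ').subset (mem_range_self t)
  rcases this with ⟨s, hs⟩ | ⟨s, hs⟩
  · exact hs ▸ hγ s
  · exact hs ▸ hγ' s

lemma intrinsicDist_smul_le {S T : Set PlaneL1} {c : ℝ} (hc : 0 < c)
    (h : ∀ s ∈ S, c • s ∈ T) (x y : PlaneL1) :
    intrinsicDist T (c • x) (c • y) ≤ ENNReal.ofReal c * intrinsicDist S x y := by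
  have hc0 : ENNReal.ofReal c ≠ 0 := by simpa using hc
  simp only [intrinsicDist, ENNReal.mul_iInf_of_ne hc0 ENNReal.ofReal_ne_top]
  refine le_iInf₂ fun γ hγ =>
    (iInf₂_le (γ.map (continuous_const_smul c)) fun t => h _ (hγ t)).trans ?_
  have := (lipschitzWith_smul (β := PlaneL1) c).lipschitzOnWith (s := univ)
    |>.comp_eVariationOn_le (mapsTo_univ γ univ)
  refine this.trans_eq ?_
  rw [← Real.enorm_eq_ofReal hc.le]
  rfl

lemma intrinsicDist_le_of_staircase {S : Set PlaneL1} {a b : ℕ → ℝ} {A B : ℝ}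
    (ha : Monotone a) (hb : Monotone b) (ha0 : a 0 = 0) (hb0 : b 0 = 0)
    (hA : Filter.Tendsto a Filter.atTop (nhds A)) (hB : Filter.Tendsto b Filter.atTop (nhds B))
    (hhor : ∀ n, ∀ x ∈ Icc (a n) (a (n + 1)), mkPt x (b n) ∈ S)
    (hver : ∀ n, ∀ y ∈ Icc (b n) (b (n + 1)), mkPt (a (n + 1)) y ∈ S)
    (hlim : mkPt A B ∈ S) :
    intrinsicDist S (mkPt 0 0) (mkPt A B) ≤ ENNReal.ofReal (A + B) := by
  have haA : ∀ n, a n ≤ A := ha.ge_of_tendsto hA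
  have hbB : ∀ n, b n ≤ B := hb.ge_of_tendsto hB
  have hA0 : 0 ≤ A := ha0 ▸ haA 0
  have hB0 : 0 ≤ B := hb0 ▸ hbB 0
  set f : ℝ → ℝ := fun s => ⨆ n, min (a (n + 1)) (s - b n) with hf
  have hbdd : ∀ s, BddAbove (range fun n => min (a (n + 1)) (s - b n)) := fun s =>
    ⟨A, by rintro _ ⟨n, rfl⟩; exact (min_le_left _ _).trans (haA _)⟩
  have hle : ∀ s n, min (a (n + 1)) (s - b n) ≤ f s := fun s n => le_ciSup (hbdd s) n
  have hmono : ∀ s t, s ≤ t → f s ≤ f t := fun s t hst => ciSup_le fun n =>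
    (min_le_min_left _ (by linarith)).trans (hle t n)
  have hlip : ∀ s t, s ≤ t → f t ≤ f s + (t - s) := fun s t hst => ciSup_le fun n => by
    have h := hle s n
    rcases min_cases (a (n + 1)) (s - b n) with h' | h' <;>
      rcases min_cases (a (n + 1)) (t - b n) with h'' | h'' <;> linarith
  have hzero : f 0 = 0 := by
    apply le_antisymm
    · refine ciSup_le fun n => (min_le_right _ _).trans ?_
      have := hb (Nat.zero_le n)
      linarith
    · have h := hle 0 0
      have := ha (Nat.zero_le 1)
      rw [hb0, sub_zero, zero_add, min_eq_right (by linarith)] at h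
      exact h
  have hone : f (A + B) = A := by
    apply le_antisymm
    · exact ciSup_le fun n => (min_le_left _ _).trans (haA _)
    · refine le_of_tendsto' hA fun n => (ha n.le_succ).trans ?_
      have h := hle (A + B) n
      rwa [min_eq_left (by linarith [haA (n + 1), hbB n])] at h
  have hmem : ∀ s, 0 ≤ s → s ≤ A + B → mkPt (f s) (s - f s) ∈ S := by
    intro s hs0 hs
    rcases hs.eq_or_lt with rfl | hs
    · rw [hone, add_sub_cancel_left]
      exact hlim
    have hex : ∃ n, s ≤ a (n + 1) + b (n + 1) := by
      have ht : Filter.Tendsto (fun n => a (n + 1) + b (n + 1)) Filter.atTop (nhds (A + B)) :=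
        (hA.comp (Filter.tendsto_add_atTop_nat 1)).add (hB.comp (Filter.tendsto_add_atTop_nat 1))
      obtain ⟨n, hn⟩ := (ht.eventually (lt_mem_nhds hs)).exists
      exact ⟨n, hn.le⟩
    classical
    set n := Nat.find hex with hn
    have hn1 : s ≤ a (n + 1) + b (n + 1) := Nat.find_spec hex
    have hn0 : a n + b n ≤ s := by
      rcases Nat.eq_zero_or_pos n with h0 | h0
      · rw [h0, ha0, hb0]; simpa using hs0
      · have := Nat.find_min hex (m := n - 1) (by omega)
        rw [Nat.sub_add_cancel h0] at this
        linarith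
    have hfs : f s = min (a (n + 1)) (s - b n) := by
      apply le_antisymm _ (hle s n)
      refine ciSup_le fun m => ?_
      have h1 := ha n.le_succ
      have h2 := hb n.le_succ
      rcases lt_trichotomy m n with hm | rfl | hm
      · have := ha (Nat.succ_le_of_lt hm)
        refine (min_le_left _ _).trans (le_min ?_ ?_)
        · exact this.trans h1
        · exact this.trans (by linarith)
      · exact le_rfl
      · have := hb (Nat.succ_le_of_lt hm)
        rw [Nat.succ_eq_add_one] at this h2
        refine (min_le_right _ _).trans (le_min ?_ ?_) <;> linarith
    rcases le_total (a (n + 1)) (s - b n) with h | h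
    · rw [hfs, min_eq_left h]
      exact hver n _ ⟨by linarith, by linarith⟩
    · rw [hfs, min_eq_right h, sub_sub_cancel]
      exact hhor n _ ⟨by linarith, h⟩
  have hlipF : LipschitzWith (Real.toNNReal (A + B))
      (fun t : ℝ => mkPt (f ((A + B) * t)) ((A + B) * t - f ((A + B) * t))) := by
    refine LipschitzWith.of_dist_le_mul fun t u => ?_
    rw [PlaneL1.dist_eq, Real.coe_toNNReal _ (by linarith), Real.dist_eq, ← abs_of_nonneg
      (show 0 ≤ A + B by linarith), ← abs_mul, abs_of_nonneg (show 0 ≤ A + B by linarith), mul_sub]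
    simp only [mkPt_fst, mkPt_snd]
    generalize (A + B) * t = t'
    generalize (A + B) * u = u'
    rcases le_total t' u' with h | h
    · have h1 := hmono _ _ h
      have h2 := hlip _ _ h
      rw [abs_of_nonpos (by linarith), abs_of_nonpos (by linarith), abs_of_nonpos (by linarith)]
      linarith
    · have h1 := hmono _ _ h
      have h2 := hlip _ _ h
      rw [abs_of_nonneg (by linarith), abs_of_nonneg (by linarith), abs_of_nonneg (by linarith)]
      linarith
  have := intrinsicDist_le_of_lipschitzWith (S := S) hlipF fun t ht =>
    hmem _ (mul_nonneg (by linarith) ht.1)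
      (mul_le_of_le_one_right (by linarith) ht.2)
  simpa [hzero, hone, ENNReal.ofReal] using this

lemma mem_carpetApprox_zero {x : PlaneL1} :
    x ∈ carpetApprox 0 ↔ (0 ≤ x.fst ∧ x.fst ≤ 1) ∧ 0 ≤ x.snd ∧ x.snd ≤ 1 := Iff.rfl

lemma mem_carpetApprox_succ {n : ℕ} {x : PlaneL1} :
    x ∈ carpetApprox (n + 1) ↔ ∃ k, ∃ z ∈ carpetApprox n, carpetMap k z = x := by
  simp [carpetApprox]

lemma carpetMap_mem_carpetApprox {n : ℕ} {x : PlaneL1} (k : Fin 8) (hx : x ∈ carpetApprox n) :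
    carpetMap k x ∈ carpetApprox (n + 1) :=
  mem_carpetApprox_succ.2 ⟨k, x, hx, rfl⟩

@[simp] lemma carpetMap_fst (k : Fin 8) (x : PlaneL1) :
    (carpetMap k x).fst = 3⁻¹ * x.fst + (carpetPt k).fst := rfl

@[simp] lemma carpetMap_snd (k : Fin 8) (x : PlaneL1) :
    (carpetMap k x).snd = 3⁻¹ * x.snd + (carpetPt k).snd := rfl

lemma carpetPt_fst_mem (k : Fin 8) :
    (carpetPt k).fst = 0 ∨ (carpetPt k).fst = 1 / 3 ∨ (carpetPt k).fst = 2 / 3 := by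
  fin_cases k <;> simp [carpetPt]

lemma carpetPt_snd_mem (k : Fin 8) :
    (carpetPt k).snd = 0 ∨ (carpetPt k).snd = 1 / 3 ∨ (carpetPt k).snd = 2 / 3 := by
  fin_cases k <;> simp [carpetPt]

lemma carpetApprox_antitone : Antitone carpetApprox := by
  refine antitone_nat_of_succ_le fun n => ?_
  induction n with
  | zero =>
    intro x hx
    obtain ⟨k, z, hz, rfl⟩ := mem_carpetApprox_succ.1 hx
    rw [mem_carpetApprox_zero] at hz ⊢
    obtain ⟨⟨h1, h2⟩, h3, h4⟩ := hz
    rw [carpetMap_fst, carpetMap_snd]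
    rcases carpetPt_fst_mem k with h | h | h <;> rcases carpetPt_snd_mem k with h' | h' | h' <;>
      rw [h, h'] <;> refine ⟨⟨?_, ?_⟩, ?_, ?_⟩ <;> linarith
  | succ n ih =>
    intro x hx
    obtain ⟨k, z, hz, rfl⟩ := mem_carpetApprox_succ.1 hx
    exact carpetMap_mem_carpetApprox k (ih hz)

lemma mem_carpet {x : PlaneL1} : x ∈ carpet ↔ ∀ n, x ∈ carpetApprox n := mem_iInter

lemma carpetMap_mem_carpet {x : PlaneL1} (k : Fin 8) (hx : x ∈ carpet) : carpetMap k x ∈ carpet :=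
  mem_carpet.2 fun n => carpetApprox_antitone n.le_succ
    (carpetMap_mem_carpetApprox k (mem_carpet.1 hx n))

lemma carpetMap_injective (k : Fin 8) : Function.Injective (carpetMap k) := fun x y h => by
  have := add_right_cancel h
  exact smul_right_injective _ (by norm_num : (3 : ℝ)⁻¹ ≠ 0) this

lemma exists_carpetMap_eq {x : PlaneL1} (hx : x ∈ carpet) :
    ∃ k, ∃ z ∈ carpet, carpetMap k z = x := by
  have key : ∃ k, ∀ m, ∃ z ∈ carpetApprox m, carpetMap k z = x := by
    by_contra! hcon
    choose m hm using hcon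
    obtain ⟨k, z, hz, hzx⟩ := mem_carpetApprox_succ.1 (mem_carpet.1 hx (Finset.univ.sup m + 1))
    exact hm k z (carpetApprox_antitone (Finset.le_sup (Finset.mem_univ k)) hz) hzx
  obtain ⟨k, hk⟩ := key
  choose z hz hzx using hk
  refine ⟨k, z 0, mem_carpet.2 fun m => ?_, hzx 0⟩
  rw [carpetMap_injective k ((hzx 0).trans (hzx m).symm)]
  exact hz m

lemma mkPt_mem_of_carpetMap {n : ℕ} {x y x' y' : ℝ} (k : Fin 8)
    (h : mkPt x' y' ∈ carpetApprox n) (hx : 3⁻¹ * x' + (carpetPt k).fst = x)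
    (hy : 3⁻¹ * y' + (carpetPt k).snd = y) : mkPt x y ∈ carpetApprox (n + 1) := by
  have : mkPt x y = carpetMap k (mkPt x' y') := PlaneL1.ext hx.symm hy.symm
  exact this ▸ carpetMap_mem_carpetApprox k h

lemma boundary_mem_carpetApprox (n : ℕ) : ∀ t ∈ Icc (0 : ℝ) 1,
    mkPt t 0 ∈ carpetApprox n ∧ mkPt t 1 ∈ carpetApprox n ∧
    mkPt 0 t ∈ carpetApprox n ∧ mkPt 1 t ∈ carpetApprox n := by
  induction n with
  | zero => rintro t ⟨h0, h1⟩; simp [mem_carpetApprox_zero, h0, h1]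
  | succ n ih =>
    rintro t ⟨h0, h1⟩
    rcases le_total t (1 / 3) with h | h
    · obtain ⟨p1, p2, p3, p4⟩ := ih (3 * t) ⟨by linarith, by linarith⟩
      refine ⟨mkPt_mem_of_carpetMap 0 p1 ?_ ?_, mkPt_mem_of_carpetMap 6 p2 ?_ ?_,
        mkPt_mem_of_carpetMap 0 p3 ?_ ?_, mkPt_mem_of_carpetMap 2 p4 ?_ ?_⟩ <;>
        simp [carpetPt] <;> linarith
    rcases le_total t (2 / 3) with h' | h'
    · obtain ⟨p1, p2, p3, p4⟩ := ih (3 * t - 1) ⟨by linarith, by linarith⟩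
      refine ⟨mkPt_mem_of_carpetMap 1 p1 ?_ ?_, mkPt_mem_of_carpetMap 5 p2 ?_ ?_,
        mkPt_mem_of_carpetMap 7 p3 ?_ ?_, mkPt_mem_of_carpetMap 3 p4 ?_ ?_⟩ <;>
        simp [carpetPt] <;> linarith
    · obtain ⟨p1, p2, p3, p4⟩ := ih (3 * t - 2) ⟨by linarith, by linarith⟩
      refine ⟨mkPt_mem_of_carpetMap 2 p1 ?_ ?_, mkPt_mem_of_carpetMap 4 p2 ?_ ?_,
        mkPt_mem_of_carpetMap 6 p3 ?_ ?_, mkPt_mem_of_carpetMap 4 p4 ?_ ?_⟩ <;>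
        simp [carpetPt] <;> linarith

lemma boundary_mem_carpet {t : ℝ} (ht : t ∈ Icc (0 : ℝ) 1) :
    mkPt t 0 ∈ carpet ∧ mkPt t 1 ∈ carpet ∧ mkPt 0 t ∈ carpet ∧ mkPt 1 t ∈ carpet := by
  simp only [mem_carpet]
  exact ⟨fun n => (boundary_mem_carpetApprox n t ht).1,
    fun n => (boundary_mem_carpetApprox n t ht).2.1,
    fun n => (boundary_mem_carpetApprox n t ht).2.2.1,
    fun n => (boundary_mem_carpetApprox n t ht).2.2.2⟩

lemma vertical_line_mem_carpet (k : Fin 8) {t : ℝ} (ht : t ∈ Icc (0 : ℝ) 1) :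
    mkPt (carpetPt k).fst t ∈ carpet := by
  obtain ⟨h0, h1⟩ := ht
  have lift : ∀ (j : Fin 8) {x y x' y' : ℝ}, mkPt x' y' ∈ carpet →
      3⁻¹ * x' + (carpetPt j).fst = x → 3⁻¹ * y' + (carpetPt j).snd = y → mkPt x y ∈ carpet := by
    intro j x y x' y' h hx hy
    have : mkPt x y = carpetMap j (mkPt x' y') := PlaneL1.ext hx.symm hy.symm
    exact this ▸ carpetMap_mem_carpet j h
  rcases carpetPt_fst_mem k with h | h | h <;> rw [h]
  · exact (boundary_mem_carpet ⟨h0, h1⟩).2.2.1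
  · rcases le_total t (1 / 3) with h | h
    · refine lift 0 (boundary_mem_carpet (t := 3 * t) ⟨by linarith, by linarith⟩).2.2.2 ?_ ?_ <;>
        simp [carpetPt]
    rcases le_total t (2 / 3) with h' | h'
    · refine lift 7 (boundary_mem_carpet (t := 3 * t - 1) ⟨by linarith, by linarith⟩).2.2.2
        ?_ ?_ <;> simp [carpetPt]; linarith
    · refine lift 6 (boundary_mem_carpet (t := 3 * t - 2) ⟨by linarith, by linarith⟩).2.2.2
        ?_ ?_ <;> simp [carpetPt]; linarith
  · rcases le_total t (1 / 3) with h | h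
    · refine lift 2 (boundary_mem_carpet (t := 3 * t) ⟨by linarith, by linarith⟩).2.2.1 ?_ ?_ <;>
        simp [carpetPt]
    rcases le_total t (2 / 3) with h' | h'
    · refine lift 3 (boundary_mem_carpet (t := 3 * t - 1) ⟨by linarith, by linarith⟩).2.2.1
        ?_ ?_ <;> simp [carpetPt]; linarith
    · refine lift 4 (boundary_mem_carpet (t := 3 * t - 2) ⟨by linarith, by linarith⟩).2.2.1
        ?_ ?_ <;> simp [carpetPt]; linarith

lemma intrinsicDist_carpet_zero_le {z : PlaneL1} (hz : z ∈ carpet) :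
    intrinsicDist carpet (mkPt 0 0) z ≤ ENNReal.ofReal (z.fst + z.snd) := by
  have hex : ∀ w : carpet, ∃ (k : Fin 8) (w' : carpet), carpetMap k w' = (w : PlaneL1) :=
    fun w => by
      obtain ⟨k, w', hw', h⟩ := exists_carpetMap_eq w.2
      exact ⟨k, ⟨w', hw'⟩, h⟩
  choose K N hKN using hex
  set u : ℕ → carpet := fun n => N^[n] ⟨z, hz⟩ with hu
  have hu_succ : ∀ n, u (n + 1) = N (u n) := fun n => Function.iterate_succ_apply' N n _
  set c : ℕ → PlaneL1 := fun n => z - ((3 : ℝ) ^ n)⁻¹ • (u n : PlaneL1) with hc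
  have hcu : ∀ n, c n + ((3 : ℝ) ^ n)⁻¹ • (u n : PlaneL1) = z := fun n => sub_add_cancel _ _
  have hstep : ∀ n, c (n + 1) = c n + ((3 : ℝ) ^ n)⁻¹ • carpetPt (K (u n)) := by
    intro n
    have h1 := hcu n
    rw [← hKN (u n), carpetMap, smul_add, smul_smul, ← hu_succ, ← mul_inv, ← pow_succ] at h1
    have h2 : c (n + 1) = z - ((3 : ℝ) ^ (n + 1))⁻¹ • (u (n + 1) : PlaneL1) := rfl
    rw [h2, sub_eq_iff_eq_add, ← h1]
    abel
  have hmem : ∀ n, ∀ w ∈ carpet, c n + ((3 : ℝ) ^ n)⁻¹ • w ∈ carpet := by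
    intro n
    induction n with
    | zero => intro w hw; simpa [hc, hu] using hw
    | succ n ih =>
      intro w hw
      have := ih _ (carpetMap_mem_carpet (K (u n)) hw)
      rw [carpetMap, smul_add, smul_smul, ← mul_inv, ← pow_succ] at this
      rwa [hstep, add_assoc, add_comm (_ • carpetPt _)]
  have hpos : ∀ n, (0 : ℝ) < ((3 : ℝ) ^ n)⁻¹ := fun n => by positivity
  have hfst : ∀ n, (c (n + 1)).fst = (c n).fst + ((3 : ℝ) ^ n)⁻¹ * (carpetPt (K (u n))).fst :=
    fun n => by rw [hstep]; rfl
  have hsnd : ∀ n, (c (n + 1)).snd = (c n).snd + ((3 : ℝ) ^ n)⁻¹ * (carpetPt (K (u n))).snd :=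
    fun n => by rw [hstep]; rfl
  have hq : ∀ k, (0 ≤ (carpetPt k).fst ∧ (carpetPt k).fst ≤ 1) ∧
      0 ≤ (carpetPt k).snd ∧ (carpetPt k).snd ≤ 1 := by
    intro k
    rcases carpetPt_fst_mem k with h | h | h <;> rcases carpetPt_snd_mem k with h' | h' | h' <;>
      rw [h, h'] <;> norm_num
  have hc0 : c 0 = 0 := by simp [hc, hu]
  have hlim : Filter.Tendsto (fun n => ((3 : ℝ) ^ n)⁻¹) Filter.atTop (nhds 0) := by
    simpa using tendsto_pow_atTop_nhds_zero_of_lt_one (r := (3 : ℝ)⁻¹) (by norm_num) (by norm_num)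
  have hbox : ∀ n, (0 ≤ (u n : PlaneL1).fst ∧ (u n : PlaneL1).fst ≤ 1) ∧
      0 ≤ (u n : PlaneL1).snd ∧ (u n : PlaneL1).snd ≤ 1 :=
    fun n => mem_carpetApprox_zero.1 (mem_carpet.1 (u n).2 0)
  have htend : ∀ {g : ℕ → ℝ} {A : ℝ}, (∀ n, 0 ≤ g n ∧ g n ≤ 1) →
      Filter.Tendsto (fun n => A - ((3 : ℝ) ^ n)⁻¹ * g n) Filter.atTop (nhds A) := by
    intro g A hg
    have : Filter.Tendsto (fun n => ((3 : ℝ) ^ n)⁻¹ * g n) Filter.atTop (nhds 0) :=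
      squeeze_zero (fun n => mul_nonneg (hpos n).le (hg n).1)
        (fun n => mul_le_of_le_one_right (hpos n).le (hg n).2) hlim
    simpa using tendsto_const_nhds.sub this
  have hscale : ∀ n {x a : ℝ}, 0 ≤ a → a ≤ 1 → ∀ {p : ℝ}, x ∈ Icc p (p + ((3 : ℝ) ^ n)⁻¹ * a) →
      ∃ t, 0 ≤ t ∧ t ≤ 1 ∧ x = p + ((3 : ℝ) ^ n)⁻¹ * t := by
    intro n x a ha0 ha1 p hx
    have h3 : (0 : ℝ) < 3 ^ n := by positivity
    refine ⟨3 ^ n * (x - p), mul_nonneg h3.le (by linarith [hx.1]), ?_, ?_⟩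
    · have := mul_le_mul_of_nonneg_left (show x - p ≤ ((3 : ℝ) ^ n)⁻¹ * a by linarith [hx.2]) h3.le
      rw [mul_inv_cancel_left₀ h3.ne'] at this
      linarith
    · rw [inv_mul_cancel_left₀ h3.ne']; ring
  have hmain := intrinsicDist_le_of_staircase (S := carpet) (a := fun n => (c n).fst)
    (b := fun n => (c n).snd) (A := z.fst) (B := z.snd)
    (monotone_nat_of_le_succ fun n => by
      rw [hfst]; exact le_add_of_nonneg_right (mul_nonneg (hpos n).le (hq _).1.1))
    (monotone_nat_of_le_succ fun n => by
      rw [hsnd]; exact le_add_of_nonneg_right (mul_nonneg (hpos n).le (hq _).2.1))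
    (by simp [hc0]) (by simp [hc0])
    (htend fun n => (hbox n).1) (htend fun n => (hbox n).2)
    (by
      intro n x hx
      rw [hfst] at hx
      obtain ⟨t, h0, h1, rfl⟩ := hscale n (hq _).1.1 (hq _).1.2 hx
      have := hmem n _ (boundary_mem_carpet ⟨h0, h1⟩).1
      convert this using 1
      exact PlaneL1.ext (by simp) (by simp))
    (by
      intro n y hy
      rw [hsnd] at hy
      obtain ⟨t, h0, h1, rfl⟩ := hscale n (hq _).2.1 (hq _).2.2 hy
      have := hmem n _ (vertical_line_mem_carpet (K (u n)) ⟨h0, h1⟩)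
      convert this using 1
      exact PlaneL1.ext (by simp [hfst]) (by simp))
    hz
  exact hmain

/-- `v` is the lower left corner of a unit square of the pre-carpet. -/
def IsCarpetCorner (v : PlaneL1) : Prop :=
  ∃ n : ℕ, ∀ m, ∀ z ∈ carpetApprox m, ((3 : ℝ) ^ n)⁻¹ • (v + z) ∈ carpetApprox (m + n)

lemma exists_corner_of_mem {U : ℕ → Set PlaneL1}
    (hU : ∀ n, ∀ x ∈ U (n + 1), ∃ k, ∃ z ∈ U n, carpetMap k z = x) (n : ℕ) :
    ∀ x ∈ U n, ∃ i j : ℤ,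
      (∀ m, ∀ z ∈ carpetApprox m, ((3 : ℝ) ^ n)⁻¹ • (mkPt i j + z) ∈ carpetApprox (m + n)) ∧
      (3 : ℝ) ^ n • x - mkPt i j ∈ U 0 := by
  induction n with
  | zero =>
    intro x hx
    have h0 : mkPt 0 0 = 0 := PlaneL1.ext (by simp) (by simp)
    exact ⟨0, 0, fun m z hz => by simpa [h0] using hz, by simpa [h0] using hx⟩
  | succ n ih =>
    intro x hx
    obtain ⟨k, x', hx', rfl⟩ := hU n x hx
    obtain ⟨i, j, hm, hsub⟩ := ih x' hx'
    have hint : ∀ t : ℝ, t = 0 ∨ t = 1 / 3 ∨ t = 2 / 3 → ∃ a : ℤ, 3 * t = a := by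
      rintro t (rfl | rfl | rfl)
      · exact ⟨0, by norm_num⟩
      · exact ⟨1, by norm_num⟩
      · exact ⟨2, by norm_num⟩
    obtain ⟨a, ha⟩ := hint _ (carpetPt_fst_mem k)
    obtain ⟨b, hb⟩ := hint _ (carpetPt_snd_mem k)
    have hv : mkPt ((i + 3 ^ n * a : ℤ) : ℝ) ((j + 3 ^ n * b : ℤ) : ℝ) =
        mkPt i j + (3 : ℝ) ^ (n + 1) • carpetPt k := by
      refine PlaneL1.ext ?_ ?_
      · simp [← ha]; ring
      · simp [← hb]; ring
    have h3 : (3 : ℝ) ^ n ≠ 0 := by positivity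
    refine ⟨i + 3 ^ n * a, j + 3 ^ n * b, fun m z hz => ?_, ?_⟩
    · have := carpetMap_mem_carpetApprox k (hm m z hz)
      change _ ∈ carpetApprox (m + n + 1)
      convert this using 1
      rw [hv]
      refine PlaneL1.ext ?_ ?_ <;> simp <;> field_simp <;> ring
    · convert hsub using 1
      rw [hv]
      refine PlaneL1.ext ?_ ?_ <;> simp <;> field_simp <;> ring

lemma exists_corner_of_mem_preCarpet {x : PlaneL1} (hx : x ∈ preCarpet) :
    ∃ i j : ℤ, IsCarpetCorner (mkPt i j) ∧ x - mkPt i j ∈ carpetApprox 0 := by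
  obtain ⟨n, y, hy, rfl⟩ := mem_iUnion.1 hx
  obtain ⟨i, j, h, h'⟩ := exists_corner_of_mem (fun n x => mem_carpetApprox_succ.1) n y hy
  exact ⟨i, j, ⟨n, h⟩, h'⟩

lemma exists_corner_of_mem_unboundedCarpet {x : PlaneL1} (hx : x ∈ unboundedCarpet) :
    ∃ i j : ℤ, IsCarpetCorner (mkPt i j) ∧ x - mkPt i j ∈ carpet := by
  obtain ⟨n, y, hy, rfl⟩ := mem_iUnion.1 hx
  obtain ⟨i, j, h, h'⟩ := exists_corner_of_mem (U := fun _ => carpet)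
    (fun n x => exists_carpetMap_eq) n y hy
  exact ⟨i, j, ⟨n, h⟩, h'⟩

lemma IsCarpetCorner.add_mem_preCarpet {v z : PlaneL1} (hv : IsCarpetCorner v)
    (hz : z ∈ carpetApprox 0) : v + z ∈ preCarpet := by
  obtain ⟨n, hn⟩ := hv
  refine mem_iUnion.2 ⟨n, ((3 : ℝ) ^ n)⁻¹ • (v + z), by simpa using hn 0 z hz, ?_⟩
  exact smul_inv_smul₀ (by positivity) _

lemma IsCarpetCorner.add_mem_unboundedCarpet {v z : PlaneL1} (hv : IsCarpetCorner v)
    (hz : z ∈ carpet) : v + z ∈ unboundedCarpet := by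
  obtain ⟨n, hn⟩ := hv
  refine mem_iUnion.2 ⟨n, ((3 : ℝ) ^ n)⁻¹ • (v + z), mem_carpet.2 fun m => ?_, ?_⟩
  · exact carpetApprox_antitone (Nat.le_add_right m n) (hn m z (mem_carpet.1 hz m))
  · exact smul_inv_smul₀ (by positivity) _

lemma unboundedCarpet_subset_preCarpet : unboundedCarpet ⊆ preCarpet :=
  iUnion_mono fun n => image_mono (iInter_subset _ n)

lemma pow_smul_mem_unboundedCarpet (n : ℕ) {x : PlaneL1} (hx : x ∈ unboundedCarpet) :
    (3 : ℝ) ^ n • x ∈ unboundedCarpet := by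
  obtain ⟨m, y, hy, rfl⟩ := mem_iUnion.1 hx
  exact mem_iUnion.2 ⟨n + m, y, hy, by simp [pow_add, mul_smul]⟩

lemma inv_pow_smul_mem_unboundedCarpet (n : ℕ) {x : PlaneL1} (hx : x ∈ unboundedCarpet) :
    ((3 : ℝ) ^ n)⁻¹ • x ∈ unboundedCarpet := by
  induction n with
  | zero => simpa using hx
  | succ n ih =>
    obtain ⟨m, y, hy, h⟩ := mem_iUnion.1 ih
    refine mem_iUnion.2 ⟨m, carpetMap 0 y, carpetMap_mem_carpet 0 hy, ?_⟩
    have h0 : carpetPt 0 = 0 := rfl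
    dsimp only at h ⊢
    rw [carpetMap, h0, add_zero, smul_comm, h, smul_smul, ← mul_inv, ← pow_succ']

lemma intrinsicDist_add_left_le {S T : Set PlaneL1} {v : PlaneL1}
    (h : ∀ s ∈ S, v + s ∈ T) (x y : PlaneL1) :
    intrinsicDist T (v + x) (v + y) ≤ intrinsicDist S x y := by
  refine le_iInf₂ fun γ hγ =>
    (iInf₂_le (γ.map (continuous_const_add v)) fun t => h _ (hγ t)).trans_eq ?_
  simp [eVariationOn, edist_add_left]

lemma intrinsicDist_self {S : Set PlaneL1} {x : PlaneL1} (hx : x ∈ S) :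
    intrinsicDist S x x = 0 := by
  have := intrinsicDist_le_edist_of_segment_subset (S := S) (x := x) (y := x)
    fun t _ => by simpa using hx
  simpa using this

lemma IsCarpetCorner.intrinsicDist_add_le {v z : PlaneL1} (hv : IsCarpetCorner v)
    (hz : z ∈ carpet) : intrinsicDist unboundedCarpet v (v + z) ≤ ENNReal.ofReal 2 := by
  have h0 : mkPt 0 0 = 0 := PlaneL1.ext (by simp) (by simp)
  have h := intrinsicDist_add_left_le (fun s hs => hv.add_mem_unboundedCarpet hs) (mkPt 0 0) z
  rw [h0, add_zero, ← h0] at h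
  refine (h.trans (intrinsicDist_carpet_zero_le hz)).trans (ENNReal.ofReal_le_ofReal ?_)
  obtain ⟨⟨-, h1⟩, -, h2⟩ := mem_carpetApprox_zero.1 (mem_carpet.1 hz 0)
  linarith

/-- Coordinatewise rounding to an integer point, with threshold `1 - θ`. -/
noncomputable def roundPt (θ : ℝ) (p : PlaneL1) : PlaneL1 :=
  mkPt ⌊p.fst + θ⌋ ⌊p.snd + θ⌋

lemma floor_add_eq_or {i : ℤ} {x θ : ℝ} (hθ : θ ∈ Ioo (0 : ℝ) 1) (h0 : i ≤ x) (h1 : x ≤ i + 1) :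
    ⌊x + θ⌋ = i ∨ ⌊x + θ⌋ = i + 1 := by
  have h2 : i ≤ ⌊x + θ⌋ := Int.le_floor.2 (by linarith [hθ.1])
  have h3 : ⌊x + θ⌋ < i + 2 := Int.floor_lt.2 (by push_cast; linarith [hθ.2])
  omega

lemma roundPt_sub_mem_carpet {p : PlaneL1} {i j : ℤ} {θ : ℝ} (hθ : θ ∈ Ioo (0 : ℝ) 1)
    (hp : p - mkPt i j ∈ carpetApprox 0) : roundPt θ p - mkPt i j ∈ carpet := by
  obtain ⟨⟨h1, h2⟩, h3, h4⟩ := mem_carpetApprox_zero.1 hp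
  simp only [WithLp.sub_fst, WithLp.sub_snd, mkPt_fst, mkPt_snd] at h1 h2 h3 h4
  have key : ∀ a b : ℝ, roundPt θ p = mkPt (i + a) (j + b) → mkPt a b ∈ carpet →
      roundPt θ p - mkPt i j ∈ carpet := by
    intro a b h hab
    rw [h]
    convert hab using 1
    exact PlaneL1.ext (by simp) (by simp)
  have hz : (0 : ℝ) ∈ Icc (0 : ℝ) 1 := by simp
  have ho : (1 : ℝ) ∈ Icc (0 : ℝ) 1 := by simp
  rcases floor_add_eq_or hθ (show (i : ℝ) ≤ p.fst by linarith) (by linarith) with hx | hx <;>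
    rcases floor_add_eq_or hθ (show (j : ℝ) ≤ p.snd by linarith) (by linarith) with hy | hy
  · exact key 0 0 (by simp [roundPt, hx, hy]) (boundary_mem_carpet hz).1
  · exact key 0 1 (by simp [roundPt, hx, hy]) (boundary_mem_carpet hz).2.1
  · exact key 1 0 (by simp [roundPt, hx, hy]) (boundary_mem_carpet ho).1
  · exact key 1 1 (by simp [roundPt, hx, hy]) (boundary_mem_carpet ho).2.1

lemma roundPt_mem_unboundedCarpet {p : PlaneL1} {θ : ℝ} (hθ : θ ∈ Ioo (0 : ℝ) 1)
    (hp : p ∈ preCarpet) : roundPt θ p ∈ unboundedCarpet := by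
  obtain ⟨i, j, hv, h⟩ := exists_corner_of_mem_preCarpet hp
  simpa using hv.add_mem_unboundedCarpet (roundPt_sub_mem_carpet hθ h)

lemma intrinsicDist_roundPt_le {p : PlaneL1} {θ : ℝ} (hθ : θ ∈ Ioo (0 : ℝ) 1)
    (hp : p ∈ unboundedCarpet) :
    intrinsicDist unboundedCarpet p (roundPt θ p) ≤ ENNReal.ofReal 4 := by
  obtain ⟨i, j, hv, h⟩ := exists_corner_of_mem_unboundedCarpet hp
  have h1 := hv.intrinsicDist_add_le h
  have h2 := hv.intrinsicDist_add_le (roundPt_sub_mem_carpet hθ (mem_carpet.1 h 0))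
  rw [add_sub_cancel] at h1 h2
  refine (intrinsicDist_triangle _ _ (mkPt i j) _).trans ?_
  rw [intrinsicDist_comm]
  refine (add_le_add h1 h2).trans ?_
  rw [← ENNReal.ofReal_add (by norm_num) (by norm_num)]
  norm_num

lemma horizontal_edge_mem {p : PlaneL1} (hp : p ∈ preCarpet) {i j : ℤ}
    (hi : (i : ℝ) < p.fst) (hi' : p.fst < i + 1) (hj : (j : ℝ) - 1 < p.snd) (hj' : p.snd < j + 1)
    {t : ℝ} (ht : t ∈ Icc (0 : ℝ) 1) : mkPt (i + t) j ∈ unboundedCarpet := by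
  obtain ⟨a, b, hv, h⟩ := exists_corner_of_mem_preCarpet hp
  obtain ⟨⟨h1, h2⟩, h3, h4⟩ := mem_carpetApprox_zero.1 h
  simp only [WithLp.sub_fst, WithLp.sub_snd, mkPt_fst, mkPt_snd] at h1 h2 h3 h4
  have ha1 : a < i + 1 := by exact_mod_cast (show (a : ℝ) < i + 1 by linarith)
  have ha2 : i < a + 1 := by exact_mod_cast (show (i : ℝ) < a + 1 by linarith)
  have hb1 : b < j + 1 := by exact_mod_cast (show (b : ℝ) < j + 1 by linarith)
  have hb2 : j - 1 < b + 1 := by exact_mod_cast (show (j : ℝ) - 1 < b + 1 by linarith)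
  obtain rfl : a = i := by omega
  obtain rfl | rfl : j = b ∨ j = b + 1 := by omega
  · convert hv.add_mem_unboundedCarpet (boundary_mem_carpet ht).1 using 1
    exact PlaneL1.ext (by simp) (by simp)
  · convert hv.add_mem_unboundedCarpet (boundary_mem_carpet ht).2.1 using 1
    exact PlaneL1.ext (by simp) (by simp)

lemma vertical_edge_mem {p : PlaneL1} (hp : p ∈ preCarpet) {i j : ℤ}
    (hi : (i : ℝ) - 1 < p.fst) (hi' : p.fst < i + 1) (hj : (j : ℝ) < p.snd) (hj' : p.snd < j + 1)
    {t : ℝ} (ht : t ∈ Icc (0 : ℝ) 1) : mkPt i (j + t) ∈ unboundedCarpet := by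
  obtain ⟨a, b, hv, h⟩ := exists_corner_of_mem_preCarpet hp
  obtain ⟨⟨h1, h2⟩, h3, h4⟩ := mem_carpetApprox_zero.1 h
  simp only [WithLp.sub_fst, WithLp.sub_snd, mkPt_fst, mkPt_snd] at h1 h2 h3 h4
  have ha1 : a < i + 1 := by exact_mod_cast (show (a : ℝ) < i + 1 by linarith)
  have ha2 : i - 1 < a + 1 := by exact_mod_cast (show (i : ℝ) - 1 < a + 1 by linarith)
  have hb1 : b < j + 1 := by exact_mod_cast (show (b : ℝ) < j + 1 by linarith)
  have hb2 : j < b + 1 := by exact_mod_cast (show (j : ℝ) < b + 1 by linarith)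
  obtain rfl : b = j := by omega
  obtain rfl | rfl : i = a ∨ i = a + 1 := by omega
  · convert hv.add_mem_unboundedCarpet (boundary_mem_carpet ht).2.2.1 using 1
    exact PlaneL1.ext (by simp) (by simp)
  · convert hv.add_mem_unboundedCarpet (boundary_mem_carpet ht).2.2.2 using 1
    exact PlaneL1.ext (by simp) (by simp)

lemma floor_add_close {x x' θ ε : ℝ} (hθ : θ ∈ Icc ε (1 - ε)) (hx : |x - x'| < ε) :
    ⌊x + θ⌋ = ⌊x' + θ⌋ ∨ ∃ i : ℤ, (i : ℝ) < x ∧ x < i + 1 ∧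
      (⌊x + θ⌋ = i ∧ ⌊x' + θ⌋ = i + 1 ∨ ⌊x + θ⌋ = i + 1 ∧ ⌊x' + θ⌋ = i) := by
  obtain ⟨h1, h2⟩ := hθ
  obtain ⟨h3, h4⟩ := abs_lt.1 hx
  have a1 := Int.floor_le (x + θ)
  have a2 := Int.lt_floor_add_one (x + θ)
  have b1 := Int.floor_le (x' + θ)
  have b2 := Int.lt_floor_add_one (x' + θ)
  rcases lt_trichotomy ⌊x + θ⌋ ⌊x' + θ⌋ with h | h | h
  · have h5 : ⌊x' + θ⌋ < ⌊x + θ⌋ + 2 := by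
      exact_mod_cast (show (⌊x' + θ⌋ : ℝ) < ⌊x + θ⌋ + 2 by linarith)
    have h6 : ⌊x' + θ⌋ = ⌊x + θ⌋ + 1 := by omega
    rw [h6] at b1 b2
    push_cast at b1 b2
    exact Or.inr ⟨⌊x + θ⌋, by linarith, by linarith, Or.inl ⟨rfl, h6⟩⟩
  · exact Or.inl h
  · have h5 : ⌊x + θ⌋ < ⌊x' + θ⌋ + 2 := by
      exact_mod_cast (show (⌊x + θ⌋ : ℝ) < ⌊x' + θ⌋ + 2 by linarith)
    have h6 : ⌊x + θ⌋ = ⌊x' + θ⌋ + 1 := by omega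
    rw [h6] at a1 a2
    push_cast at a1 a2
    exact Or.inr ⟨⌊x' + θ⌋, by linarith, by linarith, Or.inr ⟨h6, rfl⟩⟩

lemma intrinsicDist_roundPt_horizontal_le {p : PlaneL1} (hp : p ∈ preCarpet) {x' θ ε : ℝ}
    (hε : 0 < ε) (hθ : θ ∈ Icc ε (1 - ε)) (hx : |p.fst - x'| < ε) :
    intrinsicDist unboundedCarpet (roundPt θ p) (mkPt ⌊x' + θ⌋ ⌊p.snd + θ⌋) ≤
      edist (roundPt θ p) (mkPt ⌊x' + θ⌋ ⌊p.snd + θ⌋) := by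
  have hθ' : θ ∈ Ioo (0 : ℝ) 1 := ⟨hε.trans_le hθ.1, by linarith [hθ.2]⟩
  have c1 := Int.floor_le (p.snd + θ)
  have c2 := Int.lt_floor_add_one (p.snd + θ)
  refine intrinsicDist_le_edist_of_segment_subset fun t ht => ?_
  rcases floor_add_close hθ hx with h | ⟨i, h1, h2, ⟨h3, h4⟩ | ⟨h3, h4⟩⟩
  · rw [← h, ← roundPt, AffineMap.lineMap_same]
    exact roundPt_mem_unboundedCarpet hθ' hp
  · convert horizontal_edge_mem hp h1 h2 (j := ⌊p.snd + θ⌋) (by linarith [hθ'.2])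
      (by linarith [hθ'.1]) ht using 1
    rw [roundPt, h3, h4, AffineMap.lineMap_apply]
    exact PlaneL1.ext (by simp; ring) (by simp)
  · have ht' : 1 - t ∈ Icc (0 : ℝ) 1 := ⟨by linarith [ht.2], by linarith [ht.1]⟩
    convert horizontal_edge_mem hp h1 h2 (j := ⌊p.snd + θ⌋) (by linarith [hθ'.2])
      (by linarith [hθ'.1]) ht' using 1
    rw [roundPt, h3, h4, AffineMap.lineMap_apply]
    exact PlaneL1.ext (by simp; ring) (by simp)

lemma intrinsicDist_roundPt_vertical_le {p : PlaneL1} (hp : p ∈ preCarpet) {y' θ ε : ℝ}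
    (hε : 0 < ε) (hθ : θ ∈ Icc ε (1 - ε)) (hy : |p.snd - y'| < ε) :
    intrinsicDist unboundedCarpet (roundPt θ p) (mkPt ⌊p.fst + θ⌋ ⌊y' + θ⌋) ≤
      edist (roundPt θ p) (mkPt ⌊p.fst + θ⌋ ⌊y' + θ⌋) := by
  have hθ' : θ ∈ Ioo (0 : ℝ) 1 := ⟨hε.trans_le hθ.1, by linarith [hθ.2]⟩
  have c1 := Int.floor_le (p.fst + θ)
  have c2 := Int.lt_floor_add_one (p.fst + θ)
  refine intrinsicDist_le_edist_of_segment_subset fun t ht => ?_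
  rcases floor_add_close hθ hy with h | ⟨i, h1, h2, ⟨h3, h4⟩ | ⟨h3, h4⟩⟩
  · rw [← h, ← roundPt, AffineMap.lineMap_same]
    exact roundPt_mem_unboundedCarpet hθ' hp
  · convert vertical_edge_mem hp (i := ⌊p.fst + θ⌋) (by linarith [hθ'.2])
      (by linarith [hθ'.1]) h1 h2 ht using 1
    rw [roundPt, h3, h4, AffineMap.lineMap_apply]
    exact PlaneL1.ext (by simp) (by simp; ring)
  · have ht' : 1 - t ∈ Icc (0 : ℝ) 1 := ⟨by linarith [ht.2], by linarith [ht.1]⟩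
    convert vertical_edge_mem hp (i := ⌊p.fst + θ⌋) (by linarith [hθ'.2])
      (by linarith [hθ'.1]) h1 h2 ht' using 1
    rw [roundPt, h3, h4, AffineMap.lineMap_apply]
    exact PlaneL1.ext (by simp) (by simp; ring)

lemma intrinsicDist_roundPt_roundPt_le {p q : PlaneL1} (hp : p ∈ preCarpet) (hq : q ∈ preCarpet)
    {θ ε : ℝ} (hε : 0 < ε) (hθ : θ ∈ Icc ε (1 - ε)) (hpq : dist p q < ε) :
    intrinsicDist unboundedCarpet (roundPt θ p) (roundPt θ q) ≤
      ENNReal.ofReal (dist (roundPt θ p) (roundPt θ q)) := by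
  rw [PlaneL1.dist_eq] at hpq
  have hx : |p.fst - q.fst| < ε := by linarith [abs_nonneg (p.snd - q.snd)]
  have hy : |q.snd - p.snd| < ε := by
    rw [abs_sub_comm]
    linarith [abs_nonneg (p.fst - q.fst)]
  have h1 := intrinsicDist_roundPt_horizontal_le hp hε hθ hx
  have h2 := intrinsicDist_roundPt_vertical_le hq hε hθ hy
  rw [intrinsicDist_comm, edist_comm] at h2
  refine (intrinsicDist_triangle _ _ _ _).trans ((add_le_add h1 h2).trans_eq ?_)
  rw [edist_dist, edist_dist, ← ENNReal.ofReal_add dist_nonneg dist_nonneg]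
  simp [PlaneL1.dist_eq, roundPt]

lemma intrinsicDist_roundPt_le_sum {p : ℕ → PlaneL1} (hp : ∀ k, p k ∈ preCarpet)
    {θ ε : ℝ} (hε : 0 < ε) (hθ : θ ∈ Icc ε (1 - ε)) (hd : ∀ k, dist (p (k + 1)) (p k) < ε) (m : ℕ) :
    intrinsicDist unboundedCarpet (roundPt θ (p 0)) (roundPt θ (p m)) ≤
      ENNReal.ofReal (∑ k ∈ Finset.range m, dist (roundPt θ (p (k + 1))) (roundPt θ (p k))) := by
  induction m with
  | zero =>
    rw [intrinsicDist_self
      (roundPt_mem_unboundedCarpet ⟨hε.trans_le hθ.1, by linarith [hθ.2]⟩ (hp 0))]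
    exact zero_le
  | succ m ih =>
    rw [Finset.sum_range_succ, ENNReal.ofReal_add (Finset.sum_nonneg fun _ _ => dist_nonneg)
      dist_nonneg]
    refine (intrinsicDist_triangle _ _ _ _).trans (add_le_add ih ?_)
    rw [intrinsicDist_comm]
    exact intrinsicDist_roundPt_roundPt_le (hp _) (hp _) hε hθ (hd m)

lemma intervalIntegrable_floor (a b : ℝ) :
    IntervalIntegrable (fun u : ℝ => (⌊u⌋ : ℝ)) MeasureTheory.volume a b :=
  Monotone.intervalIntegrable fun _ _ h => Int.cast_le.2 (Int.floor_le_floor h)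

lemma intervalIntegrable_floor_add (x a b : ℝ) :
    IntervalIntegrable (fun θ : ℝ => (⌊x + θ⌋ : ℝ)) MeasureTheory.volume a b :=
  Monotone.intervalIntegrable fun _ _ h => Int.cast_le.2 (Int.floor_le_floor (by linarith))

lemma integral_floor_add_sub (x y : ℝ) :
    ∫ θ in (0 : ℝ)..1, ((⌊x + θ⌋ : ℝ) - ⌊y + θ⌋) = x - y := by
  rw [intervalIntegral.integral_sub (intervalIntegrable_floor_add _ _ _)
    (intervalIntegrable_floor_add _ _ _),
    intervalIntegral.integral_comp_add_left (fun u : ℝ => (⌊u⌋ : ℝ)) x,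
    intervalIntegral.integral_comp_add_left (fun u : ℝ => (⌊u⌋ : ℝ)) y,
    intervalIntegral.integral_interval_sub_interval_comm' (intervalIntegrable_floor _ _)
      (intervalIntegrable_floor _ _) (intervalIntegrable_floor _ _),
    ← intervalIntegral.integral_comp_add_right (fun u : ℝ => (⌊u⌋ : ℝ)) 1, add_zero, add_zero,
    ← intervalIntegral.integral_sub]
  · simp
  · simpa only [add_comm] using intervalIntegrable_floor_add 1 y x
  · exact intervalIntegrable_floor _ _

lemma integral_abs_floor_add_sub_le {ε : ℝ} (h0 : 0 ≤ ε) (h1 : ε ≤ 1 - ε) (x y : ℝ) :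
    ∫ θ in ε..(1 - ε), |(⌊x + θ⌋ : ℝ) - ⌊y + θ⌋| ≤ |x - y| := by
  wlog hxy : y ≤ x generalizing x y
  · rw [abs_sub_comm x y]
    simpa only [abs_sub_comm] using this y x (le_of_not_ge hxy)
  have hnn : ∀ θ : ℝ, 0 ≤ (⌊x + θ⌋ : ℝ) - ⌊y + θ⌋ := fun θ =>
    sub_nonneg.2 (Int.cast_le.2 (Int.floor_le_floor (by linarith)))
  simp only [abs_of_nonneg (hnn _)]
  rw [abs_of_nonneg (sub_nonneg.2 hxy), ← integral_floor_add_sub x y]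
  exact intervalIntegral.integral_mono_interval h0 h1 (show (1 : ℝ) - ε ≤ 1 by linarith)
    (Filter.Eventually.of_forall hnn)
    ((intervalIntegrable_floor_add _ _ _).sub (intervalIntegrable_floor_add _ _ _))

lemma intervalIntegrable_dist_roundPt (p q : PlaneL1) (a b : ℝ) :
    IntervalIntegrable (fun θ => dist (roundPt θ p) (roundPt θ q)) MeasureTheory.volume a b := by
  simp only [PlaneL1.dist_eq, roundPt, mkPt_fst, mkPt_snd]
  exact (((intervalIntegrable_floor_add _ _ _).sub (intervalIntegrable_floor_add _ _ _)).abs).add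
    (((intervalIntegrable_floor_add _ _ _).sub (intervalIntegrable_floor_add _ _ _)).abs)

lemma integral_dist_roundPt_le {ε : ℝ} (h0 : 0 ≤ ε) (h1 : ε ≤ 1 - ε) (p q : PlaneL1) :
    ∫ θ in ε..(1 - ε), dist (roundPt θ p) (roundPt θ q) ≤ dist p q := by
  simp only [PlaneL1.dist_eq, roundPt, mkPt_fst, mkPt_snd]
  rw [intervalIntegral.integral_add]
  · exact add_le_add (integral_abs_floor_add_sub_le h0 h1 _ _)
      (integral_abs_floor_add_sub_le h0 h1 _ _)
  all_goals
    exact ((intervalIntegrable_floor_add _ _ _).sub (intervalIntegrable_floor_add _ _ _)).abs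

lemma exists_sum_dist_roundPt_le {ε L : ℝ} (h0 : 0 ≤ ε) (h1 : ε ≤ 1 - ε) (p : ℕ → PlaneL1) (m : ℕ)
    (hL : ∑ k ∈ Finset.range m, dist (p (k + 1)) (p k) ≤ L) (hε : L < (1 - 2 * ε) * (L + 1)) :
    ∃ θ ∈ Icc ε (1 - ε),
      ∑ k ∈ Finset.range m, dist (roundPt θ (p (k + 1))) (roundPt θ (p k)) ≤ L + 1 := by
  by_contra! hcon
  have hint : IntervalIntegrable (fun θ => ∑ k ∈ Finset.range m,
      dist (roundPt θ (p (k + 1))) (roundPt θ (p k))) MeasureTheory.volume ε (1 - ε) := by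
    simpa only [Finset.sum_fn] using IntervalIntegrable.sum (Finset.range m)
      fun k _ => intervalIntegrable_dist_roundPt (p (k + 1)) (p k) ε (1 - ε)
  have hlow : ∫ _ in ε..(1 - ε), (L + 1) ≤ ∫ θ in ε..(1 - ε), ∑ k ∈ Finset.range m,
      dist (roundPt θ (p (k + 1))) (roundPt θ (p k)) :=
    intervalIntegral.integral_mono_on h1 intervalIntegrable_const hint
      fun θ hθ => (hcon θ hθ).le
  rw [intervalIntegral.integral_const, intervalIntegral.integral_finsetSum
    fun k _ => intervalIntegrable_dist_roundPt _ _ _ _, smul_eq_mul] at hlow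
  have hup := Finset.sum_le_sum fun k (_ : k ∈ Finset.range m) =>
    integral_dist_roundPt_le h0 h1 (p (k + 1)) (p k)
  linarith

lemma intrinsicDist_unboundedCarpet_le {x y : PlaneL1} (hx : x ∈ unboundedCarpet)
    (hy : y ∈ unboundedCarpet) :
    intrinsicDist unboundedCarpet x y ≤ intrinsicDist preCarpet x y + ENNReal.ofReal 9 := by
  conv_rhs => rw [intrinsicDist]
  simp only [ENNReal.iInf_add]
  refine le_iInf₂ fun γ hγ => ?_
  rcases eq_or_ne (eVariationOn γ univ) ⊤ with htop | htop
  · simp [htop]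
  set L := (eVariationOn γ univ).toReal with hL
  have hL0 : 0 ≤ L := ENNReal.toReal_nonneg
  set ε : ℝ := 1 / (4 * (L + 1)) with hε
  have hε0 : 0 < ε := by positivity
  have hεL : ε * (L + 1) = 1 / 4 := by rw [hε]; field_simp
  have hε1 : ε ≤ 1 / 4 := by nlinarith
  obtain ⟨δ, hδ, huc⟩ := Metric.uniformContinuous_iff.1
    (CompactSpace.uniformContinuous_of_continuous γ.continuous) ε hε0
  obtain ⟨m, hm⟩ := exists_nat_gt (1 / δ)
  have hm0 : (0 : ℝ) < m := (by positivity : 0 < 1 / δ).trans hm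
  set u : ℕ → unitInterval := fun k => projIcc (0 : ℝ) 1 zero_le_one (k / m) with hu
  have humono : Monotone u := (monotone_projIcc _).comp fun a b hab => by
    have : (a : ℝ) ≤ b := by exact_mod_cast hab
    gcongr
  have hclose : ∀ k, dist (γ (u (k + 1))) (γ (u k)) < ε := fun k => by
    apply huc
    calc dist (u (k + 1)) (u k) ≤ dist (((k + 1 : ℕ) : ℝ) / m) ((k : ℝ) / m) := by
          simpa [hu] using LipschitzWith.projIcc (zero_le_one' ℝ) |>.dist_le_mul
            (((k + 1 : ℕ) : ℝ) / m) ((k : ℝ) / m)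
      _ = 1 / m := by
          rw [Real.dist_eq, ← sub_div, Nat.cast_succ, add_sub_cancel_left,
            abs_of_pos (by positivity)]
      _ < δ := by rwa [div_lt_comm₀ hm0 hδ]
  have hsum : ∑ k ∈ Finset.range m, dist (γ (u (k + 1))) (γ (u k)) ≤ L := by
    have := eVariationOn.sum_le (f := γ) (s := univ) (n := m) humono fun _ => mem_univ _
    simp only [edist_dist] at this
    rw [← ENNReal.ofReal_sum_of_nonneg fun _ _ => dist_nonneg] at this
    exact (ENNReal.ofReal_le_iff_le_toReal htop).1 this
  obtain ⟨θ, hθ, hθsum⟩ := exists_sum_dist_roundPt_le hε0.le (by linarith) (fun k => γ (u k)) m hsum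
    (by nlinarith)
  have hθ' : θ ∈ Ioo (0 : ℝ) 1 := ⟨hε0.trans_le hθ.1, by linarith [hθ.2]⟩
  have hmid := intrinsicDist_roundPt_le_sum (p := fun k => γ (u k)) (fun k => hγ _) hε0 hθ hclose m
  have hu0 : γ (u 0) = x := by simp [hu]
  have hum : γ (u m) = y := by simp [hu, div_self hm0.ne']
  simp only [hu0, hum] at hmid
  have hend := intrinsicDist_roundPt_le hθ' hy
  rw [intrinsicDist_comm] at hend
  calc intrinsicDist unboundedCarpet x y
      ≤ intrinsicDist unboundedCarpet x (roundPt θ x) +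
        (intrinsicDist unboundedCarpet (roundPt θ x) (roundPt θ y) +
          intrinsicDist unboundedCarpet (roundPt θ y) y) :=
        (intrinsicDist_triangle _ _ _ _).trans
          (add_le_add le_rfl (intrinsicDist_triangle _ _ _ _))
    _ ≤ ENNReal.ofReal 4 + (ENNReal.ofReal (L + 1) + ENNReal.ofReal 4) :=
        add_le_add (intrinsicDist_roundPt_le hθ' hx)
          (add_le_add (hmid.trans (ENNReal.ofReal_le_ofReal hθsum)) hend)
    _ = ENNReal.ofReal L + ENNReal.ofReal 9 := by
        rw [← ENNReal.ofReal_add (by linarith) (by norm_num),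
          ← ENNReal.ofReal_add (by norm_num) (by linarith), ← ENNReal.ofReal_add hL0 (by norm_num)]
        congr 1
        ring
    _ = eVariationOn γ univ + ENNReal.ofReal 9 := by rw [hL, ENNReal.ofReal_toReal htop]

lemma exists_unboundedCarpet_intrinsicDist_preCarpet_le {x : PlaneL1} (hx : x ∈ preCarpet) :
    ∃ y ∈ unboundedCarpet, intrinsicDist preCarpet x y ≤ ENNReal.ofReal 2 := by
  obtain ⟨i, j, hv, h⟩ := exists_corner_of_mem_preCarpet hx
  have hy := hv.add_mem_unboundedCarpet (boundary_mem_carpet (t := 0) (by simp)).1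
  have h0 : mkPt 0 0 = 0 := PlaneL1.ext (by simp) (by simp)
  rw [h0, add_zero] at hy
  obtain ⟨⟨h1, h2⟩, h3, h4⟩ := mem_carpetApprox_zero.1 h
  refine ⟨_, hy, ?_⟩
  rw [intrinsicDist_comm]
  refine (intrinsicDist_le_edist_of_segment_subset fun t ht => ?_).trans ?_
  · rw [AffineMap.lineMap_apply, vsub_eq_sub, vadd_eq_add, add_comm]
    refine hv.add_mem_preCarpet (mem_carpetApprox_zero.2 ⟨⟨?_, ?_⟩, ?_, ?_⟩)
    · exact mul_nonneg ht.1 h1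
    · exact mul_le_one₀ ht.2 h1 h2
    · exact mul_nonneg ht.1 h3
    · exact mul_le_one₀ ht.2 h3 h4
  · rw [edist_comm, edist_dist, PlaneL1.dist_eq]
    rw [WithLp.sub_fst] at h1 h2
    rw [WithLp.sub_snd] at h3 h4
    rw [abs_of_nonneg h1, abs_of_nonneg h3]
    exact ENNReal.ofReal_le_ofReal (by linarith)

/-- On the unbounded Sierpiński carpet, the rescaled pre-carpet metrics `d̃ₙ`
approximate the intrinsic metric `d_∞` up to an error `C·3⁻ⁿ`, uniformly;
moreover every point of the rescaled pre-carpet `X̃ₙ = 3⁻ⁿX₀` is within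
`C·3⁻ⁿ` of `X_∞`.  In particular `(X̃ₙ, d̃ₙ, 0)` converges to
`(X_∞, d_∞, 0)` in the pointed Gromov–Hausdorff sense. -/
theorem scaledPreCarpet_dist_close :
    ∃ C : ℝ, 0 < C ∧ ∀ n : ℕ,
      (∀ x ∈ unboundedCarpet, ∀ y ∈ unboundedCarpet,
        scaledPreCarpetDist n x y ≤ intrinsicDist unboundedCarpet x y ∧
        intrinsicDist unboundedCarpet x y ≤
          scaledPreCarpetDist n x y + ENNReal.ofReal (C * ((3:ℝ) ^ n)⁻¹)) ∧
      (∀ x : PlaneL1, ((3:ℝ) ^ n) • x ∈ preCarpet →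
        ∃ y ∈ unboundedCarpet,
          scaledPreCarpetDist n x y ≤ ENNReal.ofReal (C * ((3:ℝ) ^ n)⁻¹)) := by

  refine ⟨9, by norm_num, fun n => ?_⟩
  have h3 : (0 : ℝ) < 3 ^ n := by positivity
  have hinv : ENNReal.ofReal ((3 : ℝ) ^ n)⁻¹ * ENNReal.ofReal ((3 : ℝ) ^ n) = 1 := by
    rw [← ENNReal.ofReal_mul (by positivity), inv_mul_cancel₀ h3.ne', ENNReal.ofReal_one]
  refine ⟨fun x hx y hy => ⟨?_, ?_⟩, fun x hx => ?_⟩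
  · have h := intrinsicDist_smul_le (S := unboundedCarpet) (T := preCarpet) h3
      (fun s hs => unboundedCarpet_subset_preCarpet (pow_smul_mem_unboundedCarpet n hs)) x y
    calc scaledPreCarpetDist n x y
        ≤ ENNReal.ofReal ((3 : ℝ) ^ n)⁻¹ *
          (ENNReal.ofReal ((3 : ℝ) ^ n) * intrinsicDist unboundedCarpet x y) := by
          rw [scaledPreCarpetDist]; gcongr
      _ = intrinsicDist unboundedCarpet x y := by rw [← mul_assoc, hinv, one_mul]
  · have h := intrinsicDist_smul_le (S := unboundedCarpet) (T := unboundedCarpet) (inv_pos.2 h3)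
      (fun s hs => inv_pow_smul_mem_unboundedCarpet n hs) ((3 : ℝ) ^ n • x) ((3 : ℝ) ^ n • y)
    rw [inv_smul_smul₀ h3.ne', inv_smul_smul₀ h3.ne'] at h
    have h' := intrinsicDist_unboundedCarpet_le (pow_smul_mem_unboundedCarpet n hx)
      (pow_smul_mem_unboundedCarpet n hy)
    refine h.trans ((mul_le_mul_right h' _).trans_eq ?_)
    rw [mul_add, ← ENNReal.ofReal_mul (by positivity), mul_comm _ (9 : ℝ), scaledPreCarpetDist]
  · obtain ⟨y, hy, h⟩ := exists_unboundedCarpet_intrinsicDist_preCarpet_le hx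
    refine ⟨((3 : ℝ) ^ n)⁻¹ • y, inv_pow_smul_mem_unboundedCarpet n hy, ?_⟩
    rw [scaledPreCarpetDist, smul_inv_smul₀ h3.ne']
    refine (mul_le_mul_right h _).trans ?_
    rw [← ENNReal.ofReal_mul (by positivity), mul_comm]
    exact ENNReal.ofReal_le_ofReal (by gcongr; norm_num)
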